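/- Let W ⊂ ℂᵈ be an n-dimensional linear subspace such that every nonzero vector of W has at most n - 1 zero coordinates. Let Z = { [z] ∈ ℙ^{d-1} : Σᵢ aᵢ zᵢ² = 0 for all (a₁,…,a_d) ∈ W }. Then Z is disjoint from the linear subspace H = { [z] : zᵢ = 0 for all i > n }, and dim Z = d - n - 1. -/

import Mathlib

/-- The diagonal quadratic form `Σᵢ aᵢ xᵢ²`, as a linear function of its coefficients. -/
noncomputable def diagonalQuadric (d : ℕ) : (Fin d → ℂ) →ₗ[ℂ] MvPolynomial (Fin d) ℂ :=
  Fintype.linearCombination ℂ fun i => MvPolynomial.X i ^ 2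

theorem diagonalQuadric_apply {d : ℕ} (a : Fin d → ℂ) :
    diagonalQuadric d a = ∑ i, MvPolynomial.C (a i) * MvPolynomial.X i ^ 2 := by
  simp [diagonalQuadric, Fintype.linearCombination_apply, MvPolynomial.smul_eq_C_mul]

theorem exists_mem_eq_single_of_uniform {d n : ℕ} (hnd : n < d) (W : Submodule ℂ (Fin d → ℂ))
    (hW : Module.finrank ℂ W = n)
    (hzero : ∀ a ∈ W, a ≠ 0 →
      (Finset.univ.filter fun i : Fin d => a i = 0).card ≤ n - 1)
    (i : Fin d) (hi : (i : ℕ) < n) :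
    ∃ a ∈ W, a i = 1 ∧ ∀ j : Fin d, (j : ℕ) < n → j ≠ i → a j = 0 := by
  let π : W →ₗ[ℂ] (Fin n → ℂ) := (LinearMap.funLeft ℂ ℂ (Fin.castLE hnd.le)).comp W.subtype
  have hπ (a : W) (j : Fin n) : π a j = (a : Fin d → ℂ) (Fin.castLE hnd.le j) := rfl
  have hinj : Function.Injective π := by
    rw [injective_iff_map_eq_zero]
    intro a ha
    by_contra hne
    have hcard := hzero a a.2 (by simpa using hne)
    have hsub : Finset.univ.map (Fin.castLEEmb hnd.le) ⊆
        Finset.univ.filter fun i : Fin d => (a : Fin d → ℂ) i = 0 := by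
      intro j hj
      obtain ⟨k, -, rfl⟩ := Finset.mem_map.1 hj
      simpa [ha] using (hπ a k).symm
    have := Finset.card_le_card hsub
    rw [Finset.card_map, Finset.card_univ, Fintype.card_fin] at this
    omega
  have hsurj : Function.Surjective π :=
    (LinearMap.injective_iff_surjective_of_finrank_eq_finrank (by simp [hW])).1 hinj
  obtain ⟨a, ha⟩ := hsurj (Pi.single ⟨i, hi⟩ 1)
  refine ⟨a, a.2, ?_, fun j hj hji => ?_⟩
  · simpa [ha] using (hπ a ⟨i, hi⟩).symm
  · have hne : (⟨j, hj⟩ : Fin n) ≠ ⟨i, hi⟩ := fun h => hji (Fin.ext (by simpa using h))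
    simpa [ha, hne] using (hπ a ⟨j, hj⟩).symm

theorem ringKrullDim_le_of_isIntegral {R S : Type*} [CommRing R] [CommRing S] [Algebra R S]
    [Algebra.IsIntegral R S] : ringKrullDim S ≤ ringKrullDim R :=
  Order.krullDim_le_of_strictMono (PrimeSpectrum.comap (algebraMap R S)) fun _ _ hIJ =>
    Ideal.IsIntegral.comap_lt_comap hIJ

/-- The `K`-algebra endomorphism of `K[x₀, …, x_{d-1}]` that kills the first `k` variables. -/
noncomputable def killFirstVars (K : Type*) [Field K] (d k : ℕ) :
    MvPolynomial (Fin d) K →ₐ[K] MvPolynomial (Fin d) K :=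
  MvPolynomial.aeval fun i => if (i : ℕ) < k then 0 else MvPolynomial.X i

theorem killFirstVars_X {K : Type*} [Field K] {d k : ℕ} (i : Fin d) :
    killFirstVars K d k (MvPolynomial.X i) = if (i : ℕ) < k then 0 else MvPolynomial.X i := by
  simp [killFirstVars]

instance isPrime_ker_killFirstVars (K : Type*) [Field K] (d k : ℕ) :
    (RingHom.ker (killFirstVars K d k)).IsPrime :=
  RingHom.ker_isPrime (killFirstVars K d k).toRingHom

theorem le_height_ker_killFirstVars (K : Type*) [Field K] (d : ℕ) {k : ℕ} (hk : k ≤ d) :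
    (k : ℕ∞) ≤ (RingHom.ker (killFirstVars K d k)).height := by
  induction k with
  | zero => simp
  | succ k ih =>
    have hlt : RingHom.ker (killFirstVars K d k) < RingHom.ker (killFirstVars K d (k + 1)) := by
      have hcomp : (killFirstVars K d (k + 1)).comp (killFirstVars K d k) =
          killFirstVars K d (k + 1) := by
        ext1 i
        by_cases h : (i : ℕ) < k
        · simp [killFirstVars_X, h, h.trans k.lt_succ_self]
        · simp [killFirstVars_X, h]
      refine SetLike.lt_iff_le_and_exists.2 ⟨fun p hp => ?_, MvPolynomial.X ⟨k, hk⟩, ?_, ?_⟩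
      · rw [RingHom.mem_ker] at hp ⊢
        rw [← hcomp, AlgHom.comp_apply, hp, map_zero]
      · simp [RingHom.mem_ker, killFirstVars_X]
      · simp [RingHom.mem_ker, killFirstVars_X]
    push_cast
    exact (add_le_add_left (ih (by omega)) 1).trans
      (Ideal.height_add_one_le_of_lt_of_isPrime hlt)

theorem setOf_diagonalQuadric_eq_image {d : ℕ} (W : Submodule ℂ (Fin d → ℂ)) :
    {q : MvPolynomial (Fin d) ℂ |
      ∃ a ∈ W, q = ∑ i, MvPolynomial.C (a i) * MvPolynomial.X i ^ 2} =
        diagonalQuadric d '' W := by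
  ext q
  simp [diagonalQuadric_apply, eq_comm]

theorem le_ringKrullDim_quotient_diagonalQuadric {d : ℕ} (W : Submodule ℂ (Fin d → ℂ)) :
    ((d - Module.finrank ℂ W : ℕ) : WithBot ℕ∞) ≤
      ringKrullDim (MvPolynomial (Fin d) ℂ ⧸ Ideal.span (diagonalQuadric d '' W)) := by
  let b := Module.finBasis ℂ W
  let s : Set (MvPolynomial (Fin d) ℂ) := Set.range fun j => diagonalQuadric d (b j)
  have hs : Ideal.span (diagonalQuadric d '' W) = Ideal.span s := by
    have h : diagonalQuadric d '' W = Submodule.span ℂ s := by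
      have hr : s = (diagonalQuadric d ∘ₗ W.subtype) '' Set.range b := by
        rw [← Set.range_comp]; rfl
      rw [hr, Submodule.span_image, b.span_eq, Submodule.map_comp, Submodule.map_top,
        Submodule.range_subtype, Submodule.map_coe]
    rw [h]
    exact Submodule.span_span_of_tower ..
  have hsM : s ⊆ RingHom.ker (killFirstVars ℂ d d) := by
    rintro _ ⟨j, rfl⟩
    simp [RingHom.mem_ker, diagonalQuadric_apply, killFirstVars_X]
  have hcard : s.encard ≤ Module.finrank ℂ W := by
    rw [show s = _ from Set.image_univ.symm]
    refine (Set.encard_image_le _ _).trans ?_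
    simp
  have h₁ := Ideal.height_le_ringKrullDim_quotient_add_encard s hsM
  have h₂ := le_height_ker_killFirstVars ℂ d le_rfl
  rw [hs]
  have h₃ : (d : WithBot ℕ∞) ≤
      ringKrullDim (MvPolynomial (Fin d) ℂ ⧸ Ideal.span s) + Module.finrank ℂ W :=
    (WithBot.coe_le_coe.2 h₂).trans
      (h₁.trans (add_le_add_right (WithBot.coe_le_coe.2 hcard) _))
  generalize ringKrullDim (MvPolynomial (Fin d) ℂ ⧸ Ideal.span s) = r at h₃ ⊢
  induction r with
  | bot => simp at h₃
  | coe r =>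
    induction r with
    | top => exact le_top
    | coe r =>
      have h₄ : d ≤ r + Module.finrank ℂ W := by exact_mod_cast h₃
      exact WithBot.coe_le_coe.2 (Nat.cast_le.2 (Nat.sub_le_iff_le_add.2 h₄))

theorem ringKrullDim_quotient_diagonalQuadric_le {d n : ℕ} (W : Submodule ℂ (Fin d → ℂ))
    (hW : ∀ i : Fin d, (i : ℕ) < n →
      ∃ a ∈ W, a i = 1 ∧ ∀ j : Fin d, (j : ℕ) < n → j ≠ i → a j = 0) :
    ringKrullDim (MvPolynomial (Fin d) ℂ ⧸ Ideal.span (diagonalQuadric d '' W)) ≤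
      ((d - n : ℕ) : WithBot ℕ∞) := by
  let I := Ideal.span (diagonalQuadric d '' W)
  let ι := {i : Fin d // ¬ (i : ℕ) < n}
  let f : MvPolynomial ι ℂ →+* MvPolynomial (Fin d) ℂ ⧸ I :=
    (Ideal.Quotient.mk I).comp (MvPolynomial.rename Subtype.val).toRingHom
  have hf (p) : f p = Ideal.Quotient.mk I (MvPolynomial.rename Subtype.val p) := rfl
  let _ : Algebra (MvPolynomial ι ℂ) (MvPolynomial (Fin d) ℂ ⧸ I) := f.toAlgebra
  have hmap (p) : IsIntegral (MvPolynomial ι ℂ) (f p) := isIntegral_algebraMap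
  have hlarge (i : Fin d) (hi : ¬ (i : ℕ) < n) :
      IsIntegral (MvPolynomial ι ℂ) (Ideal.Quotient.mk I (MvPolynomial.X i)) := by
    simpa [hf] using hmap (MvPolynomial.X ⟨i, hi⟩)
  have hC (c : ℂ) : IsIntegral (MvPolynomial ι ℂ) (Ideal.Quotient.mk I (MvPolynomial.C c)) := by
    simpa [hf] using hmap (MvPolynomial.C c)
  have hX (i : Fin d) :
      IsIntegral (MvPolynomial ι ℂ) (Ideal.Quotient.mk I (MvPolynomial.X i)) := by
    by_cases hi : (i : ℕ) < n
    · obtain ⟨a, haW, hai, ha⟩ := hW i hi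
      refine IsIntegral.of_pow two_pos ?_
      have hmem : diagonalQuadric d a ∈ I := Ideal.subset_span ⟨a, haW, rfl⟩
      rw [← Ideal.Quotient.eq_zero_iff_mem, diagonalQuadric_apply,
        ← Finset.add_sum_erase _ _ (Finset.mem_univ i), hai, map_one, one_mul, map_add,
        map_pow, map_sum] at hmem
      rw [eq_neg_of_add_eq_zero_left hmem]
      refine (IsIntegral.sum _ fun j hj => ?_).neg
      by_cases hj' : (j : ℕ) < n
      · rw [ha j hj' (Finset.ne_of_mem_erase hj)]
        simpa using isIntegral_zero
      · rw [map_mul, map_pow]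
        exact (hC _).mul ((hlarge j hj').pow 2)
    · exact hlarge i hi
  have : Algebra.IsIntegral (MvPolynomial ι ℂ) (MvPolynomial (Fin d) ℂ ⧸ I) := by
    refine ⟨fun x => ?_⟩
    obtain ⟨p, rfl⟩ := Ideal.Quotient.mk_surjective x
    induction p using MvPolynomial.induction_on with
    | C c => exact hC c
    | add p q hp hq => rw [map_add]; exact hp.add hq
    | mul_X p i hp => rw [map_mul]; exact hp.mul (hX i)
  refine (ringKrullDim_le_of_isIntegral (R := MvPolynomial ι ℂ)).trans ?_
  have hι : Nat.card ι ≤ d - n := by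
    let g : ι → Fin (d - n) := fun i => ⟨i.1 - n, by have := i.1.2; have := i.2; omega⟩
    have hg : Function.Injective g := fun i j hij => by
      have h : (i.1 : ℕ) - n = j.1 - n := congrArg Fin.val hij
      have := i.2
      have := j.2
      exact Subtype.ext (Fin.ext (by omega))
    simpa using Nat.card_le_card_of_injective g hg
  rw [MvPolynomial.ringKrullDim_of_isNoetherianRing, ringKrullDim_eq_zero_of_field, zero_add]
  exact_mod_cast hι

open MvPolynomial in
/- Statement 11: W ⊂ ℂᵈ an n-dimensional subspace whose nonzero vectors have at most
n - 1 zero coordinates.  Z ⊂ ℙ^{d-1} is the common zero locus of the diagonal quadrics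
Σᵢ aᵢ xᵢ², a ∈ W, and H = {[z] : zᵢ = 0 for all i > n} (1-based indexing, i.e. the
coordinates of index ≥ n in 0-based indexing vanish).  Then Z ∩ H = ∅, and
dim Z = d - n - 1: the latter is expressed by saying that the affine cone over Z, i.e.
the zero locus of the ideal generated by the quadrics, has Krull dimension d - n. -/
theorem stmt_11 (d n : ℕ) (hnd : n < d) (W : Submodule ℂ (Fin d → ℂ))
    (hW : Module.finrank ℂ W = n)
    (hzero : ∀ a ∈ W, a ≠ 0 →
      (Finset.univ.filter fun i : Fin d => a i = 0).card ≤ n - 1) :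
    ({p : Projectivization ℂ (Fin d → ℂ) | ∀ a ∈ W, ∑ i, a i * (p.rep i) ^ 2 = 0} ∩
        {p : Projectivization ℂ (Fin d → ℂ) | ∀ i : Fin d, n ≤ (i : ℕ) → p.rep i = 0} = ∅) ∧
      ringKrullDim (MvPolynomial (Fin d) ℂ ⧸
          Ideal.span {q : MvPolynomial (Fin d) ℂ |
            ∃ a ∈ W, q = ∑ i, MvPolynomial.C (a i) * MvPolynomial.X i ^ 2}) =
        ((d - n : ℕ) : WithBot ℕ∞) := by
  have hW' := exists_mem_eq_single_of_uniform hnd W hW hzero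
  refine ⟨Set.eq_empty_iff_forall_notMem.2 fun p ⟨hpZ, hpH⟩ => p.rep_nonzero ?_, ?_⟩
  · ext i
    by_cases hi : (i : ℕ) < n
    · obtain ⟨a, haW, hai, ha⟩ := hW' i hi
      have h := hpZ a haW
      rw [Finset.sum_eq_single i, hai, one_mul] at h
      · exact pow_eq_zero_iff two_ne_zero |>.1 h
      · intro j _ hji
        by_cases hj : (j : ℕ) < n
        · rw [ha j hj hji, zero_mul]
        · rw [hpH j (not_lt.1 hj), zero_pow two_ne_zero, mul_zero]
      · simp
    · exact hpH i (not_lt.1 hi)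
  · rw [setOf_diagonalQuadric_eq_image]
    exact le_antisymm (ringKrullDim_quotient_diagonalQuadric_le W hW')
      (hW ▸ le_ringKrullDim_quotient_diagonalQuadric W)
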